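/- Let d ≥ 1, ε > 0, and let x₁, …, x_N ∈ ℝ^d be pairwise distinct points. Then the N×N Gaussian kernel matrix A with entries A_{ij} = exp(−ε²·‖x_i − x_j‖₂²) is symmetric positive definite. -/

import Mathlib

open MeasureTheory in
lemma gk_aux (d : ℕ) (b : ℝ) (hb : 0 < b) : ∃ C : ℝ, 0 < C ∧
    ∀ s : EuclideanSpace ℝ (Fin d),
      Integrable (fun z : EuclideanSpace ℝ (Fin d) =>
        Real.exp (-b * ‖z‖ ^ 2 + inner ℝ s z)) ∧
      ∫ z : EuclideanSpace ℝ (Fin d), Real.exp (-b * ‖z‖ ^ 2 + inner ℝ s z)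
        = C * Real.exp (‖s‖ ^ 2 / (4 * b)) := by
  refine ⟨(Real.pi / b) ^ ((d : ℝ) / 2), by positivity, fun s => ?_⟩
  have hb' : 0 < (b : ℂ).re := by simpa using hb
  have h1 := GaussianFourier.integrable_cexp_neg_mul_sq_norm_add hb' 1 s
  have h2 := GaussianFourier.integral_cexp_neg_mul_sq_norm_add hb' 1 s
  have he : (fun z : EuclideanSpace ℝ (Fin d) =>
      Complex.exp (-(b : ℂ) * (‖z‖ : ℂ) ^ 2 + 1 * ((inner ℝ s z : ℝ) : ℂ))) =
      fun z => ((Real.exp (-b * ‖z‖ ^ 2 + inner ℝ s z) : ℝ) : ℂ) := by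
    funext z
    push_cast
    simp
  rw [he] at h1 h2
  refine ⟨h1.re, ?_⟩
  rw [integral_complex_ofReal] at h2
  rw [← Complex.ofReal_inj, h2, Complex.ofReal_mul, Complex.ofReal_cpow (by positivity)]
  simp

lemma gk_indep (d N : ℕ) (x : Fin N → EuclideanSpace ℝ (Fin d)) (hx : Function.Injective x)
    (w : Fin N → ℝ) (hw : ∀ z : EuclideanSpace ℝ (Fin d),
      ∑ i, w i * Real.exp (inner ℝ (x i) z) = 0) : ∀ i, w i = 0 := by
  let f : Fin N → (Multiplicative (EuclideanSpace ℝ (Fin d)) →* ℝ) := fun i =>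
    { toFun := fun z => Real.exp (inner ℝ (x i) z.toAdd)
      map_one' := by simp
      map_mul' := fun a b => by simp [inner_add_right, Real.exp_add] }
  have hf : Function.Injective f := by
    intro i j hij
    apply hx
    refine ext_inner_right ℝ fun z => ?_
    have := DFunLike.congr_fun hij (Multiplicative.ofAdd z)
    exact Real.exp_injective this
  have hl := (linearIndependent_monoidHom
    (Multiplicative (EuclideanSpace ℝ (Fin d))) ℝ).comp f hf
  rw [Fintype.linearIndependent_iff] at hl
  apply hl w
  funext z
  have := hw z.toAdd
  simpa [f] using this

open MeasureTheory in
/-- For `d ≥ 1`, `ε > 0`, and pairwise distinct points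
`x₁, …, x_N ∈ ℝ^d`, the `N×N` Gaussian kernel matrix with entries
`A_{ij} = exp(−ε²·‖x_i − x_j‖₂²)` is symmetric positive definite. -/
theorem gaussian_kernel_matrix_posDef
    (d N : ℕ) (hd : 1 ≤ d) (ε : ℝ) (hε : 0 < ε)
    (x : Fin N → EuclideanSpace ℝ (Fin d)) (hx : Function.Injective x) :
    (Matrix.of fun i j : Fin N =>
        Real.exp (-(ε ^ 2) * ‖x i - x j‖ ^ 2)).PosDef := by
  apply Matrix.PosDef.of_dotProduct_mulVec_pos
  · ext i j
    simp [norm_sub_rev]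
  intro v hv
  have hb : 0 < 1 / (4 * ε ^ 2) := by positivity
  obtain ⟨C, hC, h⟩ := gk_aux d _ hb
  generalize hbb : 1 / (4 * ε ^ 2) = b at *
  have hbe : ∀ r : ℝ, r / (4 * b) = ε ^ 2 * r := by
    intro r; rw [← hbb]; field_simp
  let w : Fin N → ℝ := fun i => v i * Real.exp (-(2 * ε ^ 2 * ‖x i‖ ^ 2))
  let F : EuclideanSpace ℝ (Fin d) → ℝ := fun z =>
    Real.exp (-b * ‖z‖ ^ 2) * (∑ i, w i * Real.exp (inner ℝ (x i) z)) ^ 2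
  have hFe : F = fun z => ∑ i, ∑ j, w i * w j *
      Real.exp (-b * ‖z‖ ^ 2 + inner ℝ (x i + x j) z) := by
    funext z
    simp only [F]
    rw [sq (∑ i, _), Finset.sum_mul_sum, Finset.mul_sum]
    refine Finset.sum_congr rfl fun i _ => ?_
    rw [Finset.mul_sum]
    refine Finset.sum_congr rfl fun j _ => ?_
    rw [inner_add_left, Real.exp_add, Real.exp_add]
    ring
  have hint : ∀ i j, Integrable (fun z : EuclideanSpace ℝ (Fin d) => w i * w j *
      Real.exp (-b * ‖z‖ ^ 2 + inner ℝ (x i + x j) z)) := fun i j =>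
    (h (x i + x j)).1.const_mul _
  have hFi : Integrable F := by
    rw [hFe]
    exact integrable_finsetSum _ fun i _ => integrable_finsetSum _ fun j _ => hint i j
  have hFc : Continuous F := by fun_prop
  have hF0 : 0 ≤ F := fun z => by
    simp only [F, Pi.zero_apply]
    positivity
  have hne : ∃ z, F z ≠ 0 := by
    by_contra! hz
    apply hv
    have := gk_indep d N x hx w fun z => by
      have := hz z
      simpa [F] using this
    funext i
    simpa [w] using this i
  obtain ⟨z, hz⟩ := hne
  have hpos := integral_pos_of_integrable_nonneg_nonzero (μ := volume) hFc hFi hF0 hz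
  have hval : ∫ z, F z = C * (star v ⬝ᵥ ((Matrix.of fun i j : Fin N =>
        Real.exp (-(ε ^ 2) * ‖x i - x j‖ ^ 2)).mulVec v)) := by
    rw [hFe, integral_finsetSum _ fun i _ => integrable_finsetSum _ fun j _ => hint i j]
    simp only [dotProduct, Matrix.mulVec, Finset.mul_sum]
    refine Finset.sum_congr rfl fun i _ => ?_
    rw [integral_finsetSum _ fun j _ => hint i j]
    refine Finset.sum_congr rfl fun j _ => ?_
    rw [integral_const_mul, (h (x i + x j)).2, hbe]
    have : Real.exp (-(ε ^ 2) * ‖x i - x j‖ ^ 2) = Real.exp (-(2 * ε ^ 2 * ‖x i‖ ^ 2)) *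
        Real.exp (-(2 * ε ^ 2 * ‖x j‖ ^ 2)) * Real.exp (ε ^ 2 * ‖x i + x j‖ ^ 2) := by
      rw [← Real.exp_add, ← Real.exp_add, norm_sub_sq_real, norm_add_sq_real]
      congr 1
      ring
    simp only [Matrix.of_apply, this, w, Pi.star_apply, star_trivial]
    ring
  rw [hval] at hpos
  exact pos_of_mul_pos_right hpos hC.le
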